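/- (Toom rule almost preserves thickness) If β ≤ 3·defl − 3 with defl = 2 (i.e., β ≤ 3), then θ(R(S), α, β+2) ≥ θ(S, α, β). -/

import Mathlib

open Set

abbrev Pt := ℤ × ℤ

/-- Adjacency in the graph `G`: neighbor increments
`(0,1), (0,-1), (1,0), (-1,0), (-1,1), (1,-1)`. -/
def adjG (p q : Pt) : Prop :=
  q - p ∈ ({(0,1), (0,-1), (1,0), (-1,0), (-1,1), (1,-1)} : Set Pt)

/-- Reachability within a set `S` along edges of `G`. -/
def ReachIn (S : Set Pt) (p q : Pt) : Prop :=
  Relation.ReflTransGen (fun a b => a ∈ S ∧ b ∈ S ∧ adjG a b) p q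

/-- `S` is connected in the graph `G`. -/
def ConnectedIn (S : Set Pt) : Prop :=
  ∀ p ∈ S, ∀ q ∈ S, ReachIn S p q

/-- The tile with center `p`. -/
def tile (p : Pt) : Set Pt := {p, p + (1, 0), p + (0, 1)}

/-- Inflation operation `Q`. -/
def QOp (S : Set Pt) : Set Pt := ⋃ a ∈ S, tile a

/-- Toom's rule `R`: majority of self, north, east. -/
def ROp (S : Set Pt) : Set Pt := {p | 2 ≤ (S ∩ tile p).ncard}

/-- The biased Toom rule `R⁺ = Q ∘ R ∘ R`. -/
def RPlus (S : Set Pt) : Set Pt := QOp (ROp (ROp S))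

/-- A triangle is given by parameters `(a,b,c)`; it is
`L(a,b,c) = {(α,β) : -α ≤ a, -β ≤ b, α+β ≤ c}` with span `a+b+c`. -/
abbrev Tri := ℝ × ℝ × ℝ

def triSpan (t : Tri) : ℝ := t.1 + t.2.1 + t.2.2

/-- The lattice point `p` lies in the deflation by `d` of the triangle `t`. -/
def inDefl (t : Tri) (d : ℝ) (p : Pt) : Prop :=
  -(p.1 : ℝ) ≤ t.1 - d ∧ -(p.2 : ℝ) ≤ t.2.1 - d ∧ (p.1 : ℝ) + (p.2 : ℝ) ≤ t.2.2 - d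

/-- `span(E, d)`: the minimum total span of a finite family of (nonempty)
triangles whose `d`-deflations cover `E`. -/
noncomputable def spanD (E : Set Pt) (d : ℝ) : ℝ :=
  sInf { s : ℝ | ∃ T : Finset Tri, (∀ t ∈ T, 0 ≤ triSpan t) ∧
    (∀ p ∈ E, ∃ t ∈ T, inDefl t d p) ∧ s = ∑ t ∈ T, triSpan t }

/-- `Span(E) = span(E, 2)`. -/
noncomputable def SpanE (E : Set Pt) : ℝ := spanD E 2

/-- `(C, A1, A2)` is a cut of `S`: disjoint subsets of `S` such that every
path in `S` from `A1` to `A2` passes through `C`. -/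
def IsCut (S C A1 A2 : Set Pt) : Prop :=
  C ⊆ S ∧ A1 ⊆ S ∧ A2 ⊆ S ∧
  Disjoint C A1 ∧ Disjoint C A2 ∧ Disjoint A1 A2 ∧
  ∀ p ∈ A1, ∀ q ∈ A2, ¬ ReachIn (S \ C) p q

/-- `bdry S A`: elements of `S \ A` adjacent to an element of `A`. -/
def bdry (S A : Set Pt) : Set Pt := {b | b ∈ S ∧ b ∉ A ∧ ∃ a ∈ A, adjG a b}

def IsClosedCut (S C A1 A2 : Set Pt) : Prop :=
  IsCut S C A1 A2 ∧ bdry S A1 ∪ bdry S A2 ⊆ C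

def IsConnCut (S C A1 A2 : Set Pt) : Prop :=
  IsCut S C A1 A2 ∧ ConnectedIn (A1 ∪ C) ∧ ConnectedIn (A2 ∪ C)

/-- `θ(S, α, β)`: the smallest `k` such that `S` has a connected cut with
cutting set of size `k` and `min_j Span(A_j ∪ C) > α k + β`; `∞` if none. -/
noncomputable def theta (S : Set Pt) (α β : ℝ) : ℕ∞ :=
  sInf { k : ℕ∞ | ∃ C A1 A2 : Set Pt, IsConnCut S C A1 A2 ∧ C.Finite ∧
    k = (C.ncard : ℕ∞) ∧
    α * (C.ncard : ℝ) + β < min (SpanE (A1 ∪ C)) (SpanE (A2 ∪ C)) }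

/-- `Θ(S, α)`: as `θ` but over arbitrary (not necessarily connected) cuts. -/
noncomputable def bigTheta (S : Set Pt) (α : ℝ) : ℕ∞ :=
  sInf { k : ℕ∞ | ∃ C A1 A2 : Set Pt, IsCut S C A1 A2 ∧ C.Finite ∧
    k = (C.ncard : ℕ∞) ∧
    α * (C.ncard : ℝ) < min (SpanE (A1 ∪ C)) (SpanE (A2 ∪ C)) }


lemma adjG_symm {p q : Pt} (h : adjG p q) : adjG q p := by
  obtain ⟨a, b⟩ := p
  obtain ⟨c, d⟩ := q
  simp only [adjG, mem_insert_iff, mem_singleton_iff, Prod.mk_sub_mk, Prod.mk.injEq] at *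
  omega

lemma reachIn_symm {S : Set Pt} {p q : Pt} (h : ReachIn S p q) : ReachIn S q p := by
  induction h with
  | refl => exact Relation.ReflTransGen.refl
  | tail _ hbc ih => exact Relation.ReflTransGen.head ⟨hbc.2.1, hbc.1, adjG_symm hbc.2.2⟩ ih

lemma reachIn_mono {S T : Set Pt} (hST : S ⊆ T) {p q : Pt} (h : ReachIn S p q) : ReachIn T p q := by
  induction h with
  | refl => exact Relation.ReflTransGen.refl
  | tail _ hbc ih => exact Relation.ReflTransGen.tail ih ⟨hST hbc.1, hST hbc.2.1, hbc.2.2⟩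

lemma reachIn_mem {S : Set Pt} {p q : Pt} (h : ReachIn S p q) (hp : p ∈ S) : q ∈ S := by
  induction h with
  | refl => exact hp
  | tail _ hbc _ => exact hbc.2.1

/-- A set closed under edges contains everything reachable. -/
lemma reachIn_closed {S Z : Set Pt} (hZ : ∀ a ∈ Z, ∀ b ∈ S, adjG a b → b ∈ Z) {p q : Pt}
    (h : ReachIn S p q) (hp : p ∈ Z) : q ∈ Z := by
  induction h with
  | refl => exact hp
  | tail _ hbc ih => exact hZ _ ih _ hbc.2.1 hbc.2.2

/-- Connected component. -/
def compIn (M : Set Pt) (p : Pt) : Set Pt := {q | ReachIn M p q}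

lemma compIn_sub {M : Set Pt} {p : Pt} (hp : p ∈ M) : compIn M p ⊆ M :=
  fun _ hq => reachIn_mem hq hp

lemma compIn_self {M : Set Pt} {p : Pt} : p ∈ compIn M p := Relation.ReflTransGen.refl

lemma compIn_adj {M : Set Pt} {p a b : Pt} (hp : p ∈ M) (ha : a ∈ compIn M p) (hb : b ∈ M)
    (hab : adjG a b) : b ∈ compIn M p :=
  Relation.ReflTransGen.tail ha ⟨compIn_sub hp ha, hb, hab⟩

lemma compIn_eq {M : Set Pt} {p q : Pt} (h : q ∈ compIn M p) : compIn M q = compIn M p := by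
  ext x
  exact ⟨fun hx => Relation.ReflTransGen.trans h hx,
    fun hx => Relation.ReflTransGen.trans (reachIn_symm h) hx⟩

/-- a path inside the component, finite support -/
lemma exists_finite_path {M : Set Pt} {p q : Pt} (hp : p ∈ M) (h : ReachIn M p q) :
    ∃ G : Set Pt, G.Finite ∧ p ∈ G ∧ q ∈ G ∧ G ⊆ compIn M p ∧ ∀ x ∈ G, ReachIn G p x := by
  induction h with
  | refl =>
    refine ⟨{p}, finite_singleton _, rfl, rfl, ?_, ?_⟩
    · rintro x rfl; exact compIn_self
    · rintro x rfl; exact Relation.ReflTransGen.refl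
  | @tail b c hb hbc ih =>
    obtain ⟨G, hf, hpG, hbG, hsub, hr⟩ := ih
    have hr' : ∀ x ∈ G, ReachIn (insert c G) p x :=
      fun x hx => reachIn_mono (subset_insert _ _) (hr x hx)
    refine ⟨insert c G, hf.insert _, mem_insert_of_mem _ hpG, mem_insert _ _, ?_, ?_⟩
    · rintro x (rfl | hx)
      · exact compIn_adj hp (hsub hbG) hbc.2.1 hbc.2.2
      · exact hsub hx
    · rintro x (rfl | hx)
      · exact Relation.ReflTransGen.tail (hr' b hbG)
          ⟨mem_insert_of_mem _ hbG, mem_insert _ _, hbc.2.2⟩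
      · exact hr' x hx

lemma exists_finite_conn {M : Set Pt} {p : Pt} (hp : p ∈ M) {P : Set Pt} (hP : P.Finite)
    (hPs : P ⊆ compIn M p) :
    ∃ G : Set Pt, G.Finite ∧ p ∈ G ∧ P ⊆ G ∧ G ⊆ compIn M p ∧ ConnectedIn G := by
  have key : ∀ q : Pt, ∃ G : Set Pt, q ∈ P → (G.Finite ∧ p ∈ G ∧ q ∈ G ∧ G ⊆ compIn M p ∧
      ∀ x ∈ G, ReachIn G p x) := by
    intro q
    by_cases hq : q ∈ P
    · obtain ⟨G, hG⟩ := exists_finite_path hp (hPs hq)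
      exact ⟨G, fun _ => hG⟩
    · exact ⟨∅, fun h => absurd h hq⟩
  choose g hg using key
  have hreach : ∀ x ∈ insert p (⋃ q ∈ P, g q), ReachIn (insert p (⋃ q ∈ P, g q)) p x := by
    rintro x (rfl | hx)
    · exact Relation.ReflTransGen.refl
    · simp only [mem_iUnion] at hx
      obtain ⟨q, hq, hx⟩ := hx
      refine reachIn_mono ?_ ((hg q hq).2.2.2.2 x hx)
      exact (subset_biUnion_of_mem (u := g) hq).trans (subset_insert _ _)
  refine ⟨insert p (⋃ q ∈ P, g q), ?_, mem_insert _ _, ?_, ?_, ?_⟩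
  · exact (hP.biUnion fun q hq => (hg q hq).1).insert _
  · intro q hq
    exact mem_insert_of_mem _ (mem_biUnion hq (hg q hq).2.2.1)
  · rintro x (rfl | hx)
    · exact compIn_self
    · simp only [mem_iUnion] at hx
      obtain ⟨q, hq, hx⟩ := hx
      exact (hg q hq).2.2.2.1 hx
  · intro x hx y hy
    exact Relation.ReflTransGen.trans (reachIn_symm (hreach x hx)) (hreach y hy)


/-- Hull of two triangles containing adjacent points. -/
lemma hull_bound {t u : Tri} {p q : Pt} (hp : inDefl t 0 p) (hq : inDefl u 0 q) (h : adjG p q) :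
    max t.1 u.1 + max t.2.1 u.2.1 + max t.2.2 u.2.2 ≤ triSpan t + triSpan u + 1 := by
  obtain ⟨a, b, c⟩ := t
  obtain ⟨a', b', c'⟩ := u
  obtain ⟨x, y⟩ := p
  obtain ⟨z, w⟩ := q
  simp only [adjG, mem_insert_iff, mem_singleton_iff, Prod.mk_sub_mk, Prod.mk.injEq] at h
  simp only [inDefl, triSpan, sub_zero] at *
  obtain ⟨h1, h2, h3⟩ := hp
  obtain ⟨k1, k2, k3⟩ := hq
  have hz : ∃ dx dy : ℤ, z = x + dx ∧ w = y + dy ∧ ((dx = 0 ∧ dy = 1) ∨ (dx = 0 ∧ dy = -1) ∨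
      (dx = 1 ∧ dy = 0) ∨ (dx = -1 ∧ dy = 0) ∨ (dx = -1 ∧ dy = 1) ∨ (dx = 1 ∧ dy = -1)) :=
    ⟨z - x, w - y, by ring, by ring, h⟩
  obtain ⟨dx, dy, rfl, rfl, hd⟩ := hz
  rcases max_cases a a' with ⟨e1, _⟩ | ⟨e1, _⟩ <;> rcases max_cases b b' with ⟨e2, _⟩ | ⟨e2, _⟩ <;>
  rcases max_cases c c' with ⟨e3, _⟩ | ⟨e3, _⟩ <;> rw [e1, e2, e3] <;>
  rcases hd with ⟨rfl, rfl⟩ | ⟨rfl, rfl⟩ | ⟨rfl, rfl⟩ | ⟨rfl, rfl⟩ | ⟨rfl, rfl⟩ | ⟨rfl, rfl⟩ <;>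
  push_cast at * <;> linarith

/-- Merging lemma. -/
lemma merge {ι : Type*} [DecidableEq ι] (I : Finset ι) (L : ι → Tri) (E : Set Pt)
    (hne : E.Nonempty)
    (hE : ConnectedIn E) (hcov : ∀ p ∈ E, ∃ i ∈ I, inDefl (L i) 0 p) :
    ∃ J ⊆ I, J.Nonempty ∧ ∃ H : Tri, (∀ p ∈ E, inDefl H 0 p) ∧
      triSpan H ≤ ∑ j ∈ J, (triSpan (L j) + 1) - 1 := by
  let P : Finset ι → Prop := fun J => J ⊆ I ∧ (∃ p ∈ E, ∃ j ∈ J, inDefl (L j) 0 p) ∧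
    ∃ H : Tri, (∀ p ∈ E, ∀ j ∈ J, inDefl (L j) 0 p → inDefl H 0 p) ∧
      triSpan H ≤ ∑ j ∈ J, (triSpan (L j) + 1) - 1
  have step : ∀ n : ℕ, ∀ J, P J → (I \ J).card = n → ∃ J, P J ∧ ∀ p ∈ E, ∃ j ∈ J, inDefl (L j) 0 p := by
    intro n
    induction n using Nat.strong_induction_on with
    | _ n ih =>
      intro J hJ hn
      by_cases hall : ∀ p ∈ E, ∃ j ∈ J, inDefl (L j) 0 p
      · exact ⟨J, hJ, hall⟩
      obtain ⟨hJI, ⟨p, hp, j, hj, hpj⟩, H, hH, hHs⟩ := hJ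
      have hex : ∃ a ∈ E, ∃ b ∈ E, adjG a b ∧ (∃ j ∈ J, inDefl (L j) 0 a) ∧
          ¬ ∃ j ∈ J, inDefl (L j) 0 b := by
        by_contra hno
        push Not at hno
        apply hall
        intro q hq
        have := reachIn_closed (S := E) (Z := {x | x ∈ E ∧ ∃ j ∈ J, inDefl (L j) 0 x}) ?_
          (hE p hp q hq) ⟨hp, j, hj, hpj⟩
        · exact this.2
        · rintro a ⟨ha, j', hj', haj⟩ b hb hab
          refine ⟨hb, ?_⟩
          exact hno a ha b hb hab ⟨j', hj', haj⟩
      obtain ⟨a, ha, b, hb, hab, ⟨j', hj', haj⟩, hbn⟩ := hex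
      obtain ⟨i, hi, hbi⟩ := hcov b hb
      have hiJ : i ∉ J := fun h => hbn ⟨i, h, hbi⟩
      have hHa := hH a ha j' hj' haj
      have hb' := hull_bound hHa hbi hab
      refine ih ((I \ insert i J).card) ?_ (insert i J) ?_ rfl
      · rw [← hn]
        apply Finset.card_lt_card
        refine ⟨Finset.sdiff_subset_sdiff le_rfl (Finset.subset_insert _ _), fun hsub => ?_⟩
        have := hsub (Finset.mem_sdiff.2 ⟨hi, hiJ⟩)
        simp at this
      · refine ⟨Finset.insert_subset hi hJI, ⟨p, hp, j, Finset.mem_insert_of_mem hj, hpj⟩,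
          (max H.1 (L i).1, max H.2.1 (L i).2.1, max H.2.2 (L i).2.2), ?_, ?_⟩
        · intro q hq l hl hql
          rcases Finset.mem_insert.1 hl with rfl | hl
          · obtain ⟨h1, h2, h3⟩ := hql
            simp only [inDefl, sub_zero] at *
            exact ⟨h1.trans (le_max_right _ _), h2.trans (le_max_right _ _),
              h3.trans (le_max_right _ _)⟩
          · obtain ⟨h1, h2, h3⟩ := hH q hq l hl hql
            simp only [inDefl, sub_zero] at *
            exact ⟨h1.trans (le_max_left _ _), h2.trans (le_max_left _ _),
              h3.trans (le_max_left _ _)⟩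
        · rw [Finset.sum_insert hiJ]
          simp only [triSpan] at *
          linarith
  obtain ⟨p, hp⟩ := hne
  obtain ⟨i, hi, hpi⟩ := hcov p hp
  have h0 : P {i} := by
    refine ⟨by simpa using hi, ⟨p, hp, i, by simp, hpi⟩, L i, ?_, by simp⟩
    intro q _ j hj h
    rw [Finset.mem_singleton.1 hj] at h
    exact h
  obtain ⟨J, ⟨hJI, ⟨q, hq, j, hj, _⟩, H, hH, hHs⟩, hall⟩ := step _ {i} h0 rfl
  refine ⟨J, hJI, ⟨j, hj⟩, H, ?_, hHs⟩
  intro x hx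
  obtain ⟨l, hl, hxl⟩ := hall x hx
  exact hH x hx l hl hxl

lemma spanSet_bdd (E : Set Pt) (d : ℝ) : BddBelow { s : ℝ | ∃ T : Finset Tri, (∀ t ∈ T, 0 ≤ triSpan t) ∧
    (∀ p ∈ E, ∃ t ∈ T, inDefl t d p) ∧ s = ∑ t ∈ T, triSpan t } := by
  refine ⟨0, ?_⟩
  rintro s ⟨T, hT, _, rfl⟩
  exact Finset.sum_nonneg hT

lemma SpanE_nonneg (E : Set Pt) : 0 ≤ SpanE E := by
  apply Real.sInf_nonneg
  rintro s ⟨T, hT, _, rfl⟩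
  exact Finset.sum_nonneg hT

lemma tri_nonneg {H : Tri} {p : Pt} (h : inDefl H 0 p) : 0 ≤ triSpan H := by
  obtain ⟨h1, h2, h3⟩ := h
  simp only [triSpan]
  linarith

lemma SpanE_le {E : Set Pt} (hne : E.Nonempty) {H : Tri} (hH : ∀ p ∈ E, inDefl H 0 p) :
    SpanE E ≤ triSpan H + 6 := by
  obtain ⟨p, hp⟩ := hne
  have h0 := tri_nonneg (hH p hp)
  apply csInf_le (spanSet_bdd E 2)
  refine ⟨{(H.1 + 2, H.2.1 + 2, H.2.2 + 2)}, ?_, ?_, ?_⟩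
  · intro t ht
    rw [Finset.mem_singleton.1 ht]
    simp only [triSpan] at *
    linarith
  · intro q hq
    refine ⟨_, Finset.mem_singleton_self _, ?_⟩
    obtain ⟨h1, h2, h3⟩ := hH q hq
    simp only [inDefl]
    refine ⟨?_, ?_, ?_⟩ <;> linarith
  · simp only [triSpan, Finset.sum_singleton]
    ring

lemma SpanE_empty : SpanE ∅ = 0 := by
  refine le_antisymm ?_ (SpanE_nonneg _)
  apply csInf_le (spanSet_bdd ∅ 2)
  exact ⟨∅, by simp, by simp, by simp⟩

lemma tri_finite (t : Tri) (d : ℝ) : {p : Pt | inDefl t d p}.Finite := by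
  refine (Set.finite_Icc ((⌈d - t.1⌉, ⌈d - t.2.1⌉) : Pt)
    ((⌊t.2.2 - d + (t.2.1 - d)⌋, ⌊t.2.2 - d + (t.1 - d)⌋) : Pt)).subset ?_
  rintro ⟨x, y⟩ ⟨h1, h2, h3⟩
  simp only at h1 h2 h3
  refine ⟨⟨?_, ?_⟩, ⟨?_, ?_⟩⟩ <;> simp only [Int.ceil_le, Int.le_floor] <;> linarith

lemma finite_of_SpanE_pos {E : Set Pt} (h : 0 < SpanE E) : E.Finite := by
  by_contra hinf
  have : { s : ℝ | ∃ T : Finset Tri, (∀ t ∈ T, 0 ≤ triSpan t) ∧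
    (∀ p ∈ E, ∃ t ∈ T, inDefl t 2 p) ∧ s = ∑ t ∈ T, triSpan t } = ∅ := by
    rw [eq_empty_iff_forall_notMem]
    rintro s ⟨T, _, hc, _⟩
    apply hinf
    refine (T.finite_toSet.biUnion (t := fun t => {p : Pt | inDefl t 2 p})
      fun t _ => tri_finite t 2).subset ?_
    intro p hp
    obtain ⟨t, ht, hpt⟩ := hc p hp
    exact mem_biUnion (by exact ht) hpt
  rw [SpanE, spanD, this, Real.sInf_empty] at h
  exact lt_irrefl _ h

lemma finite_tri_cover {E : Set Pt} (hE : E.Finite) (hne : E.Nonempty) :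
    ∃ H : Tri, (∀ p ∈ E, inDefl H 0 p) ∧
      ∀ K : Tri, (∀ p ∈ E, inDefl K 0 p) → triSpan H ≤ triSpan K := by
  obtain ⟨p, hp, hpm⟩ := Set.exists_max_image E (fun p : Pt => -(p.1 : ℝ)) hE hne
  obtain ⟨q, hq, hqm⟩ := Set.exists_max_image E (fun p : Pt => -(p.2 : ℝ)) hE hne
  obtain ⟨r, hr, hrm⟩ := Set.exists_max_image E (fun p : Pt => (p.1 : ℝ) + (p.2 : ℝ)) hE hne
  refine ⟨(-(p.1 : ℝ), -(q.2 : ℝ), (r.1 : ℝ) + (r.2 : ℝ)), ?_, ?_⟩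
  · intro x hx
    simp only [inDefl, sub_zero]
    exact ⟨hpm x hx, hqm x hx, hrm x hx⟩
  · intro K hK
    have h1 := (hK p hp).1
    have h2 := (hK q hq).2.1
    have h3 := (hK r hr).2.2
    simp only [triSpan]
    linarith

/-- A finite connected set is covered by a single triangle of the right span. -/
lemma exists_tri {G : Set Pt} (hf : G.Finite) (hne : G.Nonempty) (hc : ConnectedIn G) :
    ∃ H : Tri, (∀ p ∈ G, inDefl H 0 p) ∧ triSpan H + 6 ≤ SpanE G := by
  classical
  obtain ⟨H, hH, hmin⟩ := finite_tri_cover hf hne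
  refine ⟨H, hH, ?_⟩
  apply le_csInf
  · refine ⟨_, {(H.1 + 2, H.2.1 + 2, H.2.2 + 2)}, ?_, ?_, rfl⟩
    · intro t ht
      obtain ⟨p, hp⟩ := hne
      have h0 := tri_nonneg (hH p hp)
      rw [Finset.mem_singleton.1 ht]
      simp only [triSpan] at *
      linarith
    · intro q hq
      refine ⟨_, Finset.mem_singleton_self _, ?_⟩
      obtain ⟨h1, h2, h3⟩ := hH q hq
      simp only [inDefl]
      refine ⟨?_, ?_, ?_⟩ <;> linarith
  · rintro s ⟨T, hT, hcov, rfl⟩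
    obtain ⟨J, hJ, hJne, K, hK, hKs⟩ := merge T (fun t => (t.1 - 2, t.2.1 - 2, t.2.2 - 2)) G hne hc
      (by
        intro p hp
        obtain ⟨t, ht, hpt⟩ := hcov p hp
        refine ⟨t, ht, ?_⟩
        simpa only [inDefl, sub_zero] using hpt)
    have h1 := hmin K hK
    have h2 : ∑ j ∈ J, triSpan j ≤ ∑ j ∈ T, triSpan j :=
      Finset.sum_le_sum_of_subset_of_nonneg hJ fun t ht _ => hT t ht
    have h3 : ∑ j ∈ J, (triSpan (j.1 - 2, j.2.1 - 2, j.2.2 - 2) + 1)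
        = ∑ j ∈ J, triSpan j - 5 * (J.card : ℝ) := by
      have : ∀ j ∈ J, (triSpan (j.1 - 2, j.2.1 - 2, j.2.2 - 2) + 1) = triSpan j + (-5) := by
        intro j _
        simp only [triSpan]
        ring
      rw [Finset.sum_congr rfl this, Finset.sum_add_distrib, Finset.sum_const, nsmul_eq_mul]
      ring
    have h4 : (1 : ℝ) ≤ J.card := by exact_mod_cast hJne.card_pos
    rw [h3] at hKs
    linarith

lemma mem_tile {p q : Pt} : q ∈ tile p ↔ q = p ∨ q = p + (1, 0) ∨ q = p + (0, 1) := by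
  simp [tile]

/-- Counting lemma. -/
lemma counting {E M D : Set Pt} {α β : ℝ} (hα : 0 ≤ α) (hβ : β ≤ 3) (hf : E.Finite)
    (hne : E.Nonempty) (hE : ConnectedIn E) (hD : D.Finite)
    (hM : ∀ e ∈ E, ∃ x ∈ M, x ∈ tile e)
    (hsmall : ∀ p ∈ M, ∀ G : Set Pt, G.Finite → ConnectedIn G → compIn M p ∩ D ⊆ G →
      G ⊆ compIn M p → SpanE G ≤ α * ((compIn M p ∩ D).ncard : ℝ) + β) :
    SpanE E ≤ α * (D.ncard : ℝ) + β + 2 := by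
  classical
  have hM' : ∀ e : Pt, ∃ x : Pt, e ∈ E → x ∈ M ∧ x ∈ tile e := by
    intro e
    by_cases he : e ∈ E
    · obtain ⟨x, h⟩ := hM e he
      exact ⟨x, fun _ => h⟩
    · exact ⟨e, fun h => absurd h he⟩
  choose f hfM using hM'
  have hL : ∀ N : Set Pt, ∃ L : Tri, (∃ e ∈ E, compIn M (f e) = N) →
      (∀ e ∈ E, f e ∈ N → inDefl L 0 (f e)) ∧ triSpan L + 6 ≤ α * ((N ∩ D).ncard : ℝ) + β := by
    intro N
    by_cases hN : ∃ e ∈ E, compIn M (f e) = N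
    · obtain ⟨e, he, rfl⟩ := hN
      have hp := (hfM e he).1
      obtain ⟨G, hGf, hpG, hPG, hGs, hGc⟩ := exists_finite_conn hp
        (P := compIn M (f e) ∩ (D ∪ f '' E))
        ((hD.union (hf.image f)).subset inter_subset_right) inter_subset_left
      obtain ⟨H, hH, hHs⟩ := exists_tri hGf ⟨_, hpG⟩ hGc
      refine ⟨H, fun _ => ⟨?_, ?_⟩⟩
      · intro e' he' hfe
        exact hH _ (hPG ⟨hfe, Or.inr ⟨e', he', rfl⟩⟩)
      · exact hHs.trans (hsmall _ hp G hGf hGc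
          (fun x hx => hPG ⟨hx.1, Or.inl hx.2⟩) hGs)
    · exact ⟨(0, 0, 0), fun h => absurd h hN⟩
  choose L hL using hL
  let I : Finset (Set Pt) := hf.toFinset.image (fun e => compIn M (f e))
  have hI : ∀ N ∈ I, ∃ e ∈ E, compIn M (f e) = N := by
    intro N hN
    obtain ⟨e, he, h⟩ := Finset.mem_image.1 hN
    exact ⟨e, by simpa using he, h⟩
  obtain ⟨J, hJI, hJne, H, hH, hHs⟩ := merge I
    (fun N => ((L N).1 + 1, (L N).2.1 + 1, (L N).2.2)) E hne hE (by
      intro e he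
      refine ⟨compIn M (f e), Finset.mem_image.2 ⟨e, by simpa using he, rfl⟩, ?_⟩
      obtain ⟨h1, h2, h3⟩ := (hL _ ⟨e, he, rfl⟩).1 e he compIn_self
      generalize L (compIn M (f e)) = l at h1 h2 h3 ⊢
      simp only [inDefl, sub_zero] at *
      rcases mem_tile.1 (hfM e he).2 with h | h | h <;> rw [h] at h1 h2 h3 <;>
        push_cast [Prod.fst_add, Prod.snd_add] at h1 h2 h3 <;>
        refine ⟨?_, ?_, ?_⟩ <;> linarith)
  have h1 := SpanE_le hne hH
  have h2 : ∑ N ∈ J, (triSpan ((L N).1 + 1, (L N).2.1 + 1, (L N).2.2) + 1)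
      ≤ ∑ N ∈ J, (α * ((N ∩ D).ncard : ℝ) + (β - 3)) := by
    apply Finset.sum_le_sum
    intro N hN
    have := (hL N (hI N (hJI hN))).2
    simp only [triSpan] at *
    linarith
  have hsum : ∑ N ∈ J, (N ∩ D).ncard ≤ D.ncard := by
    have hcard : ∀ N : Set Pt, (N ∩ D).ncard = (hD.toFinset.filter (· ∈ N)).card := by
      intro N
      rw [← Set.ncard_coe_finset]
      congr 1
      ext x
      simp [and_comm]
    rw [Finset.sum_congr rfl fun N _ => hcard N, ← Finset.card_biUnion,
      Set.ncard_eq_toFinset_card D hD]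
    · apply Finset.card_le_card
      intro x hx
      obtain ⟨N, _, hx⟩ := Finset.mem_biUnion.1 hx
      exact (Finset.mem_filter.1 hx).1
    · intro N hN N' hN' hne'
      rw [Function.onFun, Finset.disjoint_left]
      intro x hx hx'
      have hx := (Finset.mem_filter.1 hx).2
      have hx' := (Finset.mem_filter.1 hx').2
      obtain ⟨e, he, rfl⟩ := hI N (hJI hN)
      obtain ⟨e', he', rfl⟩ := hI N' (hJI hN')
      exact hne' ((compIn_eq hx).symm.trans (compIn_eq hx'))
  have hsum' : (∑ N ∈ J, ((N ∩ D).ncard : ℝ)) ≤ (D.ncard : ℝ) := by exact_mod_cast hsum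
  have h2' : ∑ N ∈ J, (α * ((N ∩ D).ncard : ℝ) + (β - 3))
      = α * ∑ N ∈ J, ((N ∩ D).ncard : ℝ) + (J.card : ℝ) * (β - 3) := by
    rw [Finset.sum_add_distrib, ← Finset.mul_sum, Finset.sum_const, nsmul_eq_mul]
  rw [h2'] at h2
  have h3 := mul_le_mul_of_nonneg_left hsum' hα
  have h4 : (1 : ℝ) ≤ J.card := by exact_mod_cast hJne.card_pos
  have h5 : (J.card : ℝ) * (β - 3) ≤ 1 * (β - 3) :=
    mul_le_mul_of_nonpos_right h4 (by linarith)
  linarith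


lemma tile_finite (p : Pt) : (tile p).Finite := by
  simp only [tile]
  exact Set.toFinite _

lemma tiles_adj {s c t : Pt} (hc : s ∈ tile c) (ht : s ∈ tile t) : c = t ∨ adjG t c := by
  obtain ⟨a, b⟩ := s
  obtain ⟨c, d⟩ := c
  obtain ⟨e, f⟩ := t
  simp only [mem_tile, adjG, mem_insert_iff, mem_singleton_iff, Prod.mk_sub_mk, Prod.mk_add_mk,
    Prod.mk.injEq] at *
  omega

lemma edge_tile {s s' : Pt} (h : adjG s s') : ∃ c, s ∈ tile c ∧ s' ∈ tile c := by
  obtain ⟨a, b⟩ := s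
  obtain ⟨c, d⟩ := s'
  refine ⟨(min a c, min b d), ?_⟩
  simp only [mem_tile, adjG, mem_insert_iff, mem_singleton_iff, Prod.mk_sub_mk, Prod.mk_add_mk,
    Prod.mk.injEq] at *
  omega

lemma adjG_ne {s s' : Pt} (h : adjG s s') : s ≠ s' := by
  rintro rfl
  simp [adjG, Prod.ext_iff] at h

lemma mem_ROp_of_two {S : Set Pt} {s s' c : Pt} (hs : s ∈ S) (hs' : s' ∈ S) (h : s ≠ s')
    (hc : s ∈ tile c) (hc' : s' ∈ tile c) : c ∈ ROp S := by
  have h2 : ({s, s'} : Set Pt).ncard = 2 := Set.ncard_pair h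
  show 2 ≤ (S ∩ tile c).ncard
  rw [← h2]
  apply Set.ncard_le_ncard
  · rintro x (rfl | rfl)
    · exact ⟨hs, hc⟩
    · exact ⟨hs', hc'⟩
  · exact (tile_finite c).subset inter_subset_right

lemma ROp_nonempty {S : Set Pt} {c : Pt} (h : c ∈ ROp S) : ∃ x ∈ S, x ∈ tile c := by
  have h : 2 ≤ (S ∩ tile c).ncard := h
  have : (S ∩ tile c).Nonempty := by
    rw [← Set.ncard_pos ((tile_finite c).subset inter_subset_right)]
    omega
  obtain ⟨x, hx⟩ := this
  exact ⟨x, hx.1, hx.2⟩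

/-- Choice of a point of the tile that destroys all crossing edges. -/
lemma exists_minority {S V : Set Pt} {c : Pt} (h : c ∈ ROp S) :
    ∃ x ∈ S, x ∈ tile c ∧ ∀ s ∈ S, ∀ s' ∈ S, s ∈ tile c → s' ∈ tile c → s ∈ V → s' ∉ V →
      s = x ∨ s' = x := by
  by_contra hno
  push Not at hno
  obtain ⟨x, hx, hxc⟩ := ROp_nonempty h
  obtain ⟨s, hs, s', hs', hsc, hsc', hV, hV', _, _⟩ := hno x hx hxc
  obtain ⟨u, hu, u', hu', huc, huc', hU, hU', n1, n2⟩ := hno s hs hsc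
  obtain ⟨v, hv, v', hv', hvc, hvc', hW, hW', n3, n4⟩ := hno s' hs' hsc'
  have e1 : u ≠ u' := fun h => hU' (h ▸ hU)
  have e2 : u ≠ s' := fun h => hV' (h ▸ hU)
  have e3 : v' ≠ s := fun h => hW' (h ▸ hV)
  have e4 : u ≠ v' := fun h => hW' (h ▸ hU)
  have e5 : s ≠ s' := fun h => hV' (h ▸ hV)
  rw [mem_tile] at hsc hsc' huc hvc'
  clear hno
  grind

/-- Main construction. -/
lemma main_cut {S C A1 A2 : Set Pt} {α β : ℝ} (hα : 0 ≤ α) (hβ0 : 0 ≤ β) (hβ : β ≤ 3)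
    (hcut : IsConnCut (ROp S) C A1 A2) (hC : C.Finite)
    (h1 : α * (C.ncard : ℝ) + (β + 2) < SpanE (A1 ∪ C))
    (h2 : α * (C.ncard : ℝ) + (β + 2) < SpanE (A2 ∪ C)) :
    ∃ C' A1' A2' : Set Pt, IsConnCut S C' A1' A2' ∧ C'.Finite ∧ C'.ncard ≤ C.ncard ∧
      α * (C'.ncard : ℝ) + β < min (SpanE (A1' ∪ C')) (SpanE (A2' ∪ C')) := by
  obtain ⟨⟨hCS, hA1, hA2, hd1, hd2, hd12, hsep⟩, hc1, hc2⟩ := hcut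
  have hnn : 0 ≤ α * (C.ncard : ℝ) := by positivity
  have hf1 : (A1 ∪ C).Finite := finite_of_SpanE_pos (by linarith)
  have hf2 : (A2 ∪ C).Finite := finite_of_SpanE_pos (by linarith)
  have hn1 : (A1 ∪ C).Nonempty := by
    rw [nonempty_iff_ne_empty]
    intro h
    rw [h, SpanE_empty] at h1
    linarith
  have hn2 : (A2 ∪ C).Nonempty := by
    rw [nonempty_iff_ne_empty]
    intro h
    rw [h, SpanE_empty] at h2
    linarith
  let W : Set Pt := {t | ∃ a ∈ A1, ReachIn (ROp S \ C) a t}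
  have hA1' : ∀ a ∈ A1, a ∈ ROp S \ C := fun a ha =>
    ⟨hA1 ha, fun h => disjoint_left.1 hd1 h ha⟩
  have hA2' : ∀ a ∈ A2, a ∈ ROp S \ C := fun a ha =>
    ⟨hA2 ha, fun h => disjoint_left.1 hd2 h ha⟩
  have hWcl : ∀ t ∈ W, ∀ c ∈ ROp S \ C, (c = t ∨ adjG t c) → c ∈ W := by
    rintro t ⟨a, ha, hr⟩ c hc (rfl | hadj)
    · exact ⟨a, ha, hr⟩
    · exact ⟨a, ha, Relation.ReflTransGen.tail hr ⟨reachIn_mem hr (hA1' a ha), hc, hadj⟩⟩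
  let V : Set Pt := {s | s ∈ S ∧ ∃ t ∈ W, s ∈ tile t}
  have hg : ∀ c : Pt, ∃ x : Pt, c ∈ C → x ∈ S ∧ x ∈ tile c ∧
      ∀ s ∈ S, ∀ s' ∈ S, s ∈ tile c → s' ∈ tile c → s ∈ V → s' ∉ V → s = x ∨ s' = x := by
    intro c
    by_cases hc : c ∈ C
    · obtain ⟨x, hx⟩ := exists_minority (V := V) (hCS hc)
      exact ⟨x, fun _ => hx⟩
    · exact ⟨c, fun h => absurd h hc⟩
  choose g hg using hg
  set C' : Set Pt := g '' C with hC'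
  have hC'f : C'.Finite := hC.image g
  have hC'S : C' ⊆ S := by
    rintro _ ⟨c, hc, rfl⟩
    exact (hg c hc).1
  have hC'card : C'.ncard ≤ C.ncard := Set.ncard_image_le hC
  have hcross : ∀ s ∈ V, s ∉ C' → ∀ s' ∈ S, s' ∉ V → s' ∉ C' → ¬ adjG s s' := by
    intro s hs hsC s' hs' hs'V hs'C hadj
    obtain ⟨c, hsc, hs'c⟩ := edge_tile hadj
    have hcR : c ∈ ROp S := mem_ROp_of_two hs.1 hs' (adjG_ne hadj) hsc hs'c
    by_cases hcC : c ∈ C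
    · rcases (hg c hcC).2.2 s hs.1 s' hs' hsc hs'c hs hs'V with h | h
      · exact hsC ⟨c, hcC, h.symm⟩
      · exact hs'C ⟨c, hcC, h.symm⟩
    · obtain ⟨t, ht, hst⟩ := hs.2
      exact hs'V ⟨hs', c, hWcl t ht c ⟨hcR, hcC⟩ (tiles_adj hsc hst), hs'c⟩
  have hVS : V ⊆ S := fun s hs => hs.1
  have hK : ∃ p ∈ V ∪ C', ∃ G : Set Pt, G.Finite ∧ ConnectedIn G ∧
      compIn (V ∪ C') p ∩ C' ⊆ G ∧ G ⊆ compIn (V ∪ C') p ∧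
      α * ((compIn (V ∪ C') p ∩ C').ncard : ℝ) + β < SpanE G := by
    by_contra hno
    push Not at hno
    have := counting hα hβ hf1 hn1 hc1 hC'f (M := V ∪ C') (by
      rintro e (he | he)
      · obtain ⟨x, hx, hxe⟩ := ROp_nonempty (hA1 he)
        exact ⟨x, Or.inl ⟨hx, e, ⟨e, he, Relation.ReflTransGen.refl⟩, hxe⟩, hxe⟩
      · exact ⟨g e, Or.inr ⟨e, he, rfl⟩, (hg e he).2.1⟩)
      (fun p hp G a b c d => hno p hp G a b c d)
    have hm : α * (C'.ncard : ℝ) ≤ α * (C.ncard : ℝ) :=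
      mul_le_mul_of_nonneg_left (by exact_mod_cast hC'card) hα
    linarith
  obtain ⟨p, hp, G1, hG1f, hG1c, hG1D, hG1K, hG1s⟩ := hK
  set K := compIn (V ∪ C') p with hKdef
  have hKsub : K ⊆ V ∪ C' := compIn_sub hp
  have hDf : (K ∩ C').Finite := hC'f.subset inter_subset_right
  have hDcard : (K ∩ C').ncard ≤ C.ncard :=
    (Set.ncard_le_ncard inter_subset_right hC'f).trans hC'card
  have hN : ∃ q ∈ S \ (K \ C'), ∃ G : Set Pt, G.Finite ∧ ConnectedIn G ∧
      compIn (S \ (K \ C')) q ∩ (K ∩ C') ⊆ G ∧ G ⊆ compIn (S \ (K \ C')) q ∧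
      α * ((compIn (S \ (K \ C')) q ∩ (K ∩ C')).ncard : ℝ) + β < SpanE G := by
    by_contra hno
    push Not at hno
    have := counting hα hβ hf2 hn2 hc2 hDf (M := S \ (K \ C')) (by
      rintro e (he | he)
      · obtain ⟨x, hx, hxe⟩ := ROp_nonempty (hA2 he)
        refine ⟨x, ⟨hx, ?_⟩, hxe⟩
        rintro ⟨hxK, hxC⟩
        rcases hKsub hxK with hxV | hxC'
        · obtain ⟨t, ht, hxt⟩ := hxV.2
          obtain ⟨a, ha, hr⟩ := hWcl t ht e (hA2' e he) (tiles_adj hxe hxt)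
          exact hsep a ha e he hr
        · exact hxC hxC'
      · exact ⟨g e, ⟨(hg e he).1, fun h => h.2 ⟨e, he, rfl⟩⟩, (hg e he).2.1⟩)
      (fun p hp G a b c d => hno p hp G a b c d)
    have hm : α * ((K ∩ C').ncard : ℝ) ≤ α * (C.ncard : ℝ) :=
      mul_le_mul_of_nonneg_left (by exact_mod_cast hDcard) hα
    linarith
  obtain ⟨q, hq, G2, hG2f, hG2c, hG2D, hG2N, hG2s⟩ := hN
  set N := compIn (S \ (K \ C')) q with hNdef
  have hNsub : N ⊆ S \ (K \ C') := compIn_sub hq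
  set D := N ∩ (K ∩ C') with hDdef
  have hDG1 : D ⊆ G1 := fun x hx => hG1D hx.2
  have hDle : D.ncard ≤ (K ∩ C').ncard := Set.ncard_le_ncard inter_subset_right hDf
  have hKN : ∀ x ∈ K, x ∈ N → x ∈ D := by
    intro x hxK hxN
    refine ⟨hxN, hxK, ?_⟩
    by_contra hxC
    exact (hNsub hxN).2 ⟨hxK, hxC⟩
  have hu1 : G1 \ D ∪ D = G1 := sdiff_union_of_subset hDG1
  have hu2 : G2 \ D ∪ D = G2 := sdiff_union_of_subset hG2D
  have hKS : K ⊆ S := fun x hx => (hKsub hx).elim (fun h => hVS h) (fun h => hC'S h)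
  refine ⟨D, G1 \ D, G2 \ D, ⟨⟨?_, ?_, ?_, ?_, ?_, ?_, ?_⟩, ?_, ?_⟩, ?_, ?_, ?_⟩
  · exact fun x hx => hKS hx.2.1
  · exact fun x hx => hKS (hG1K hx.1)
  · exact fun x hx => (hNsub (hG2N hx.1)).1
  · exact disjoint_sdiff_right
  · exact disjoint_sdiff_right
  · rw [disjoint_left]
    intro x hx hx'
    exact hx.2 (hKN x (hG1K hx.1) (hG2N hx'.1))
  · intro x hx y hy hr
    have hr' := reachIn_symm hr
    have := reachIn_closed (Z := N \ D) ?_ hr' ⟨hG2N hy.1, hy.2⟩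
    · exact hx.2 (hKN x (hG1K hx.1) this.1)
    · rintro n ⟨hnN, hnD⟩ z ⟨hzS, hzD⟩ hadj
      refine ⟨?_, hzD⟩
      by_contra hzN
      have hzM : z ∈ K \ C' := by
        by_contra hz
        exact hzN (compIn_adj hq hnN ⟨hzS, hz⟩ hadj)
      have hnK : n ∉ K := fun h => hnD (hKN n h hnN)
      have hnM : n ∉ V ∪ C' := fun h => hnK (compIn_adj hp hzM.1 h (adjG_symm hadj))
      have hzV : z ∈ V := (hKsub hzM.1).elim id (fun h => absurd h hzM.2)
      exact hcross z hzV hzM.2 n (hNsub hnN).1 (fun h => hnM (Or.inl h))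
        (fun h => hnM (Or.inr h)) (adjG_symm hadj)
  · rw [hu1]; exact hG1c
  · rw [hu2]; exact hG2c
  · exact hDf.subset inter_subset_right
  · exact hDle.trans hDcard
  · rw [hu1, hu2]
    apply lt_min
    · have hm : α * (D.ncard : ℝ) ≤ α * ((K ∩ C').ncard : ℝ) :=
        mul_le_mul_of_nonneg_left (by exact_mod_cast hDle) hα
      linarith
    · exact hG2s

lemma theta_le_of {S C A1 A2 : Set Pt} {α β : ℝ} (h : IsConnCut S C A1 A2) (hC : C.Finite)
    (hs : α * (C.ncard : ℝ) + β < min (SpanE (A1 ∪ C)) (SpanE (A2 ∪ C))) {k : ℕ}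
    (hk : C.ncard ≤ k) : theta S α β ≤ (k : ℕ∞) := by
  refine le_trans (sInf_le ⟨C, A1, A2, h, hC, rfl, hs⟩) ?_
  exact_mod_cast hk

lemma isConnCut_self {S C : Set Pt} (hC : C ⊆ S) (hc : ConnectedIn C) : IsConnCut S C ∅ ∅ := by
  refine ⟨⟨hC, empty_subset _, empty_subset _, disjoint_empty _, disjoint_empty _,
    disjoint_empty _, fun p hp => absurd hp (notMem_empty p)⟩, ?_, ?_⟩ <;>
  rw [empty_union] <;> exact hc

/-- Toom's rule almost preserves thickness: if `β ≤ 3` then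
`θ(R(S), α, β+2) ≥ θ(S, α, β)`. -/
theorem toom_almost_preserves_thickness (S : Set Pt) (α β : ℝ) (hβ : β ≤ 3) :
    theta S α β ≤ theta (ROp S) α (β + 2) := by
  apply le_sInf
  rintro k ⟨C, A1, A2, hcut, hC, rfl, hs⟩
  obtain ⟨h1, h2⟩ := lt_min_iff.1 hs
  rcases lt_or_ge β 0 with hβ0 | hβ0
  · apply theta_le_of (isConnCut_self (empty_subset S) fun p hp => absurd hp (notMem_empty p))
      finite_empty
    · simpa [SpanE_empty] using hβ0
    · simp
  rcases le_or_gt 0 α with hα | hα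
  · obtain ⟨C', A1', A2', hc, hf, hle, hsp⟩ := main_cut hα hβ0 hβ hcut hC h1 h2
    exact theta_le_of hc hf hsp hle
  rcases Nat.eq_zero_or_pos C.ncard with h0 | hpos
  · obtain ⟨C', A1', A2', hc, hf, hle, hsp⟩ := main_cut (α := 0) le_rfl hβ0 hβ hcut hC
      (by simpa [h0] using h1) (by simpa [h0] using h2)
    have h0' : C'.ncard = 0 := by omega
    exact theta_le_of hc hf (by simpa [h0'] using hsp) hle
  · obtain ⟨c, hc⟩ := (Set.ncard_pos hC).1 hpos
    obtain ⟨x, hx, _⟩ := ROp_nonempty (hcut.1.1 hc)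
    have hconn : ConnectedIn ({x} : Set Pt) := by
      rintro p rfl q rfl
      exact Relation.ReflTransGen.refl
    apply theta_le_of (isConnCut_self (S := S) (C := {x}) (by simpa using hx) hconn)
      (finite_singleton x)
    · obtain ⟨H, hH, hHs⟩ := exists_tri (finite_singleton x) (singleton_nonempty x) hconn
      have := tri_nonneg (hH x rfl)
      simp only [ncard_singleton, empty_union, min_self, Nat.cast_one, mul_one]
      linarith
    · rw [ncard_singleton]; exact hpos
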